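/- For every uniformly Σ¹₁ family (Aₙ) of subsets of ℕ with each Aₙ either all of ℕ or nonempty and finite, there exists a uniformly Σ¹₁ family (Bₖ) of subsets of ℕ with each Bₖ either all of ℕ or a singleton, such that ∏ₙAₙ ≤_M ∏ₖBₖ. -/

import Mathlib

open Set

/-- Baire space. -/
abbrev Baire : Type := ℕ → ℕ

/-- The length-`n` initial segment of `x : Baire`, as a finite sequence. -/
def pre (x : Baire) (n : ℕ) : List ℕ := (List.range n).map x

/-- A Turing functional, presented by a total computable monotone map on
finite sequences. -/
structure TuringFunctional where
  φ : List ℕ → List ℕ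
  computable : Computable φ
  mono : ∀ σ τ : List ℕ, σ <+: τ → φ σ <+: φ τ

/-- `Φ` is defined on `x` with value `y`: every coordinate of `y` is eventually
output by `Φ` on initial segments of `x`. -/
def TuringFunctional.Eval (Φ : TuringFunctional) (x y : Baire) : Prop :=
  ∀ n, ∃ m, (Φ.φ (pre x m))[n]? = some (y n)

/-- Medvedev reducibility: some Turing functional is defined on every element
of `Q` and maps `Q` into `P`. -/
def MedvedevLE (P Q : Set Baire) : Prop :=
  ∃ Φ : TuringFunctional, ∀ x ∈ Q, ∃ y ∈ P, Φ.Eval x y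

/-- Strict Medvedev reducibility. -/
def MedvedevLT (P Q : Set Baire) : Prop := MedvedevLE P Q ∧ ¬ MedvedevLE Q P

/-- The homogeneous set `∏ₙ Aₙ`. -/
def homProd (A : ℕ → Set ℕ) : Set Baire := {x | ∀ n, x n ∈ A n}

/-- A family `(Aₙ)` of subsets of `ℕ` is uniformly `Σ¹₁`. -/
def UniformlySigma11 (A : ℕ → Set ℕ) : Prop :=
  ∃ R : ℕ × ℕ → List ℕ → Bool, Computable₂ R ∧
    ∀ n m : ℕ, m ∈ A n ↔ ∃ y : Baire, ∀ k, R (n, m) (pre y k) = true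

/-- A subset of Baire space is (lightface) `Σ¹₁`. -/
def Sigma11Set (S : Set Baire) : Prop :=
  ∃ R : List ℕ → List ℕ → Bool, Computable₂ R ∧
    ∀ x, x ∈ S ↔ ∃ y : Baire, ∀ m, R (pre x m) (pre y m) = true

/-- A set of finite sequences is (lightface) `Σ¹₁`. -/
def Sigma11List (T : Set (List ℕ)) : Prop :=
  ∃ R : List ℕ → List ℕ → Bool, Computable₂ R ∧
    ∀ σ, σ ∈ T ↔ ∃ y : Baire, ∀ m, R σ (pre y m) = true

/-- A tree on `ℕ`: a set of finite sequences closed under prefixes. -/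
def IsTree (T : Set (List ℕ)) : Prop := ∀ σ ∈ T, ∀ τ : List ℕ, τ <+: σ → τ ∈ T

/-- The set `[T]` of infinite paths through `T`. -/
def paths (T : Set (List ℕ)) : Set Baire := {x | ∀ n, pre x n ∈ T}

/-- A subset of `ℕ × ℕ` is (lightface) `Σ¹₁`. -/
def Sigma11Pairs (A : Set (ℕ × ℕ)) : Prop :=
  ∃ R : ℕ × ℕ → List ℕ → Bool, Computable₂ R ∧
    ∀ p : ℕ × ℕ, p ∈ A ↔ ∃ y : Baire, ∀ k, R p (pre y k) = true

/-- A function `f : ℕ → ℕ` is `Δ¹₁`: its graph is both `Σ¹₁` and `Π¹₁`. -/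
def Delta11Fun (f : ℕ → ℕ) : Prop :=
  Sigma11Pairs {p : ℕ × ℕ | f p.1 = p.2} ∧ Sigma11Pairs {p : ℕ × ℕ | f p.1 ≠ p.2}

@[simp]
theorem pre_length (x : Baire) (n : ℕ) : (pre x n).length = n := by simp [pre]

theorem pre_getElem? (x : Baire) {i n : ℕ} (h : i < n) : (pre x n)[i]? = some (x i) := by
  simp [pre, h]

theorem pre_getD (x : Baire) {i n : ℕ} (h : i < n) : (pre x n).getD i 0 = x i := by
  simp [pre, h]

theorem pre_take (x : Baire) {m n : ℕ} (h : m ≤ n) : (pre x n).take m = pre x m := by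
  simp [pre, ← List.map_take, List.take_range, h]

theorem pre_succ (x : Baire) (n : ℕ) : pre x (n + 1) = pre x n ++ [x n] := by
  simp [pre, List.range_succ]

theorem pre_succ' (x : Baire) (n : ℕ) :
    pre x (n + 1) = x 0 :: pre (fun i => x (i + 1)) n := by
  simp [pre, List.range_succ_eq_map, Function.comp_def]

/-- A lightface `Σ¹₁` predicate on a coded type. -/
def IsSigma11 {α : Type} [Primcodable α] (p : α → Prop) : Prop :=
  ∃ R : α → List ℕ → Bool, Computable₂ R ∧ ∀ a, p a ↔ ∃ y : Baire, ∀ k, R a (pre y k) = true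

namespace IsSigma11

variable {α β : Type} [Primcodable α] [Primcodable β] {p q : α → Prop}

/-- A number quantifier over a matrix that inspects a computably bounded initial segment
of the witness can be absorbed into the normal form. -/
theorem of_bounded_use {g : α → β → ℕ} {Q : α → β → List ℕ → Bool} (hg : Computable₂ g)
    (hQ : Computable fun t : (α × β) × List ℕ => Q t.1.1 t.1.2 t.2)
    (h : ∀ a, p a ↔ ∃ y : Baire, ∀ b, Q a b (pre y (g a b)) = true) : IsSigma11 p := by
  refine ⟨fun a τ => ((Encodable.decode (α := β) τ.length.unpair.1).map fun b =>
    bif decide (g a b ≤ τ.length) then Q a b (τ.take (g a b)) else true).getD true, ?_, ?_⟩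
  · have hi : Computable fun t : α × List ℕ =>
        Encodable.decode (α := β) t.2.length.unpair.1 :=
      Computable.decode.comp (Computable.fst.comp
        (Primrec.unpair.to_comp.comp (Computable.list_length.comp Computable.snd)))
    have hg' : Computable fun t : (α × List ℕ) × β => g t.1.1 t.2 :=
      hg.comp (Computable.fst.comp Computable.fst) Computable.snd
    have hτ : Computable fun t : (α × List ℕ) × β => t.1.2 :=
      Computable.snd.comp Computable.fst
    have hc : Computable fun t : (α × List ℕ) × β => decide (g t.1.1 t.2 ≤ t.1.2.length) :=
      Primrec.nat_le.decide.to_comp.comp hg' (Computable.list_length.comp hτ)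
    have ht : Computable fun t : (α × List ℕ) × β => t.1.2.take (g t.1.1 t.2) :=
      Primrec.list_take.to_comp.comp hg' hτ
    have hQ' : Computable fun t : (α × List ℕ) × β => Q t.1.1 t.2 (t.1.2.take (g t.1.1 t.2)) :=
      Computable.comp (f := fun t : (α × β) × List ℕ => Q t.1.1 t.1.2 t.2)
        (g := fun t : (α × List ℕ) × β => ((t.1.1, t.2), t.1.2.take (g t.1.1 t.2))) hQ
        (((Computable.fst.comp Computable.fst).pair Computable.snd).pair ht)
    have hm : Computable₂ fun (t : α × List ℕ) (b : β) =>
        bif decide (g t.1 b ≤ t.2.length) then Q t.1 b (t.2.take (g t.1 b)) else true :=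
      Computable.cond hc hQ' (Computable.const true)
    exact Computable.option_getD (Computable.option_map hi hm) (Computable.const true)
  · intro a
    rw [h]
    refine exists_congr fun y => ⟨fun H k => ?_, fun H b => ?_⟩
    · cases e : Encodable.decode (α := β) (Nat.unpair k).1 with
      | none => simp [e]
      | some b =>
        by_cases hk : g a b ≤ k
        · simp [e, hk, pre_take, H]
        · simp [e, hk]
    · have hk : g a b ≤ Nat.pair (Encodable.encode b) (g a b) := Nat.right_le_pair _ _
      have := H (Nat.pair (Encodable.encode b) (g a b))
      simpa [hk, pre_take] using this

theorem comp (hp : IsSigma11 p) {f : β → α} (hf : Computable f) :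
    IsSigma11 fun b => p (f b) := by
  obtain ⟨R, hR, h⟩ := hp
  exact ⟨fun b => R (f b), hR.comp (hf.comp Computable.fst) Computable.snd, fun b => h (f b)⟩

theorem congr (hp : IsSigma11 p) (h : ∀ a, q a ↔ p a) : IsSigma11 q := by
  rwa [show q = p from funext fun a => propext (h a)]

theorem exists_nat {p : α × ℕ → Prop} (hp : IsSigma11 p) :
    IsSigma11 fun a => ∃ n, p (a, n) := by
  obtain ⟨R, hR, h⟩ := hp
  refine of_bounded_use (β := ℕ) (g := fun _ k => k + 1)
    (Q := fun a _ τ => R (a, τ.headI) τ.tail) (Computable.succ.comp Computable.snd) ?_ ?_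
  · exact hR.comp ((Computable.fst.comp Computable.fst).pair
      (Primrec.list_headI.to_comp.comp Computable.snd))
      (Primrec.list_tail.to_comp.comp Computable.snd)
  · intro a
    simp only [h, pre_succ', List.headI_cons, List.tail_cons]
    constructor
    · rintro ⟨n, y, hy⟩
      exact ⟨fun i => Nat.casesOn i n y, hy⟩
    · rintro ⟨y, hy⟩
      exact ⟨y 0, _, hy⟩

theorem forall_nat {p : α × ℕ → Prop} (hp : IsSigma11 p) :
    IsSigma11 fun a => ∀ n, p (a, n) := by
  obtain ⟨R, hR, h⟩ := hp
  refine of_bounded_use (β := ℕ × ℕ) (g := fun _ b => Nat.pair b.1 b.2)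
    (Q := fun a b τ => R (a, b.1) ((List.range b.2).map fun i => τ.getD (Nat.pair b.1 i) 0))
    ?_ ?_ ?_
  · exact Primrec₂.natPair.to_comp.comp (Computable.fst.comp Computable.snd)
      (Computable.snd.comp Computable.snd)
  · refine hR.comp ((Computable.fst.comp Computable.fst).pair
      (Computable.fst.comp (Computable.snd.comp Computable.fst))) (Primrec.to_comp ?_)
    refine Primrec.list_map (Primrec.list_range.comp
      (Primrec.snd.comp (Primrec.snd.comp Primrec.fst))) ?_
    exact (Primrec.list_getD 0).comp (Primrec.snd.comp Primrec.fst)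
      (Primrec₂.natPair.comp
        (Primrec.fst.comp (Primrec.snd.comp (Primrec.fst.comp Primrec.fst))) Primrec.snd)
  · intro a
    have key : ∀ (y : Baire) (n k : ℕ), ((List.range k).map fun i =>
        (pre y (Nat.pair n k)).getD (Nat.pair n i) 0) = pre (fun i => y (Nat.pair n i)) k := by
      intro y n k
      refine List.map_congr_left fun i hi => ?_
      exact pre_getD y (Nat.pair_lt_pair_right n (List.mem_range.1 hi))
    simp only [h, key]
    constructor
    · intro H
      choose y hy using H
      exact ⟨fun j => y j.unpair.1 j.unpair.2, fun b => by simpa using hy b.1 b.2⟩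
    · rintro ⟨y, hy⟩ n
      exact ⟨fun i => y (Nat.pair n i), fun k => hy (n, k)⟩

theorem ite {c : α → Bool} (hc : Computable c) (hp : IsSigma11 p) (hq : IsSigma11 q) :
    IsSigma11 fun a => if c a then p a else q a := by
  obtain ⟨R, hR, h⟩ := hp
  obtain ⟨S, hS, h'⟩ := hq
  refine ⟨fun a τ => bif c a then R a τ else S a τ,
    Computable.cond (hc.comp Computable.fst) hR hS, fun a => ?_⟩
  simp only [h, h']
  cases c a <;> simp

theorem and (hp : IsSigma11 p) (hq : IsSigma11 q) : IsSigma11 fun a => p a ∧ q a := by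
  have hc : Computable fun t : α × ℕ => decide (t.2 = 0) :=
    Primrec.eq.decide.to_comp.comp Computable.snd (Computable.const 0)
  refine (forall_nat (ite hc (hp.comp Computable.fst) (hq.comp Computable.fst))).congr
    fun a => ⟨fun H n => ?_, fun H => ⟨by simpa using H 0, by simpa using H 1⟩⟩
  by_cases hn : n = 0 <;> simp [hn, H.1, H.2]

theorem of_computable {c : α → Bool} (hc : Computable c) : IsSigma11 fun a => c a = true :=
  ⟨fun a _ => c a, hc.comp Computable.fst, fun _ => by simp⟩

end IsSigma11

section TreeRank

variable {X : Type} (ch : X → ℕ → X) (ok : X → Bool)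

/-- `v` is an admissible child of `u` in the tree with child function `ch` and
admissibility test `ok`. -/
def IsChild (v u : X) : Prop := ∃ a, v = ch u a ∧ ok v = true

open Classical in
/-- The rank of a node, with value `⊤` on the ill-founded part. -/
noncomputable def treeRank (u : X) : WithTop Ordinal.{0} :=
  if h : Acc (IsChild ch ok) u then (h.rank : WithTop Ordinal.{0}) else ⊤

/-- Strict inequality, made reflexive at `⊤`. -/
def SLt (x y : WithTop Ordinal.{0}) : Prop := y = ⊤ ∨ x < y

variable {ch ok}

theorem treeRank_of_acc {u : X} (h : Acc (IsChild ch ok) u) :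
    treeRank ch ok u = (h.rank : WithTop Ordinal.{0}) := dif_pos h

theorem treeRank_eq_top_iff {u : X} : treeRank ch ok u = ⊤ ↔ ¬ Acc (IsChild ch ok) u := by
  by_cases h : Acc (IsChild ch ok) u <;> simp [treeRank, h]

theorem slt_of_isChild {u v : X} (h : IsChild ch ok v u) :
    SLt (treeRank ch ok v) (treeRank ch ok u) := by
  by_cases hu : Acc (IsChild ch ok) u
  · right
    rw [treeRank_of_acc hu, treeRank_of_acc (hu.inv h)]
    exact WithTop.coe_lt_coe.2 (Acc.rank_lt_of_rel hu h)
  · exact Or.inl (treeRank_eq_top_iff.2 hu)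

theorem treeRank_le_iff {u v : X} : treeRank ch ok u ≤ treeRank ch ok v ↔
    ∀ a, ok (ch u a) = true → SLt (treeRank ch ok (ch u a)) (treeRank ch ok v) := by
  constructor
  · intro h a ha
    rcases slt_of_isChild (ch := ch) (ok := ok) ⟨a, rfl, ha⟩ with h' | h'
    · exact Or.inl (top_le_iff.1 (h' ▸ h))
    · exact Or.inr (h'.trans_le h)
  · intro h
    by_cases hv : Acc (IsChild ch ok) v
    · have hlt : ∀ w, IsChild ch ok w u → treeRank ch ok w < treeRank ch ok v := by
        rintro w ⟨a, rfl, ha⟩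
        exact (h a ha).resolve_left fun e => treeRank_eq_top_iff.1 e hv
      have hu : Acc (IsChild ch ok) u := by
        refine Acc.intro u fun w hw => ?_
        by_contra hn
        exact not_top_lt (treeRank_eq_top_iff.2 hn ▸ hlt w hw)
      rw [treeRank_of_acc hu, treeRank_of_acc hv, WithTop.coe_le_coe, hu.rank_eq]
      refine Ordinal.iSup_le fun w => Order.succ_le_of_lt ?_
      have := hlt w.1 w.2
      rwa [treeRank_of_acc (hu.inv w.2), treeRank_of_acc hv, WithTop.coe_lt_coe] at this
    · rw [treeRank_eq_top_iff.2 hv]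
      exact le_top

theorem slt_treeRank_iff {u v : X} : SLt (treeRank ch ok u) (treeRank ch ok v) ↔
    ∃ b, ok (ch v b) = true ∧ treeRank ch ok u ≤ treeRank ch ok (ch v b) := by
  constructor
  · intro h
    by_contra! hn
    rcases h with h | h
    · refine treeRank_eq_top_iff.1 h (Acc.intro v ?_)
      rintro w ⟨b, rfl, hb⟩
      by_contra hw
      exact not_top_lt ((treeRank_eq_top_iff.2 hw).symm.trans_lt
        ((hn b hb).trans_le le_top))
    · exact h.not_ge (treeRank_le_iff.2 fun b hb => Or.inr (hn b hb))
  · rintro ⟨b, hb, hle⟩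
    exact (slt_of_isChild ⟨b, rfl, hb⟩).imp_right hle.trans_lt

theorem treeRank_eq_top_iff_exists {u : X} : treeRank ch ok u = ⊤ ↔
    ∃ s : ℕ → X, s 0 = u ∧ ∀ n, IsChild ch ok (s (n + 1)) (s n) := by
  constructor
  · intro h
    have step : ∀ v : {v : X // treeRank ch ok v = ⊤},
        ∃ w : {v : X // treeRank ch ok v = ⊤}, IsChild ch ok w.1 v.1 := by
      rintro ⟨v, hv⟩
      obtain ⟨b, hb, hle⟩ := slt_treeRank_iff.1 (Or.inl hv : SLt (treeRank ch ok v) _)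
      exact ⟨⟨ch v b, top_le_iff.1 (hv ▸ hle)⟩, b, rfl, hb⟩
    choose f hf using step
    exact ⟨fun n => (f^[n] ⟨u, h⟩).1, rfl, fun n => by
      simpa only [Function.iterate_succ_apply'] using hf (f^[n] ⟨u, h⟩)⟩
  · rintro ⟨s, rfl, hs⟩
    rw [treeRank_eq_top_iff]
    intro hacc
    have : ∀ v, Acc (IsChild ch ok) v → ∀ n, s n ≠ v := by
      intro v hv
      induction hv with
      | intro v _ ih =>
        rintro n rfl
        exact ih _ (hs n) (n + 1) rfl
    exact this _ hacc 0 rfl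

theorem isSigma11_treeRank_le [Primcodable X] (hch : Computable₂ ch) (hok : Computable ok) :
    IsSigma11 fun t : X × X => treeRank ch ok t.1 ≤ treeRank ch ok t.2 := by
  let e : X → X → ℕ → ℕ := fun u v a => Encodable.encode (u, v, a)
  have he : ∀ {γ : Type} [Primcodable γ] {f g : γ → X} {h : γ → ℕ}, Computable f →
      Computable g → Computable h → Computable fun c => e (f c) (g c) (h c) :=
    fun hf hg hh => Computable.encode.comp (hf.pair (hg.pair hh))
  let l₁ : (X × X) → (X × X) × (ℕ × ℕ × ℕ) → ℕ := fun t i => e t.1 t.2 i.2.1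
  let l₂ : (X × X) → (X × X) × (ℕ × ℕ × ℕ) → ℕ := fun _ i => e i.1.1 i.1.2 i.2.1
  let l₃ : (X × X) → (X × X) × (ℕ × ℕ × ℕ) → ℕ := fun _ i =>
    e (ch i.1.1 i.2.1) (ch i.1.2 i.2.2.1) i.2.2.2
  have hu : Computable fun t : (X × X) × (X × X) × (ℕ × ℕ × ℕ) => t.2.1.1 :=
    Computable.fst.comp (Computable.fst.comp Computable.snd)
  have hv : Computable fun t : (X × X) × (X × X) × (ℕ × ℕ × ℕ) => t.2.1.2 :=
    Computable.snd.comp (Computable.fst.comp Computable.snd)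
  have ha : Computable fun t : (X × X) × (X × X) × (ℕ × ℕ × ℕ) => t.2.2.1 :=
    Computable.fst.comp (Computable.snd.comp Computable.snd)
  have hb : Computable fun t : (X × X) × (X × X) × (ℕ × ℕ × ℕ) => t.2.2.2.1 :=
    Computable.fst.comp (Computable.snd.comp (Computable.snd.comp Computable.snd))
  have hc : Computable fun t : (X × X) × (X × X) × (ℕ × ℕ × ℕ) => t.2.2.2.2 :=
    Computable.snd.comp (Computable.snd.comp (Computable.snd.comp Computable.snd))
  have hl₁ : Computable₂ l₁ := he (Computable.fst.comp Computable.fst)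
    (Computable.snd.comp Computable.fst) ha
  have hl₂ : Computable₂ l₂ := he hu hv ha
  have hl₃ : Computable₂ l₃ := he (hch.comp hu ha) (hch.comp hv hb) hc
  have hadd : Computable₂ ((· + ·) : ℕ → ℕ → ℕ) := Primrec.nat_add.to_comp
  have lookup : ∀ {l : (X × X) → (X × X) × (ℕ × ℕ × ℕ) → ℕ}, Computable₂ l →
      Computable fun t : ((X × X) × (X × X) × (ℕ × ℕ × ℕ)) × List ℕ =>
        t.2.getD (l t.1.1 t.1.2) 0 := fun {l} hl =>
    (Primrec.list_getD 0).to_comp.comp Computable.snd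
      (Computable.comp (f := fun t : (X × X) × (X × X) × (ℕ × ℕ × ℕ) => l t.1 t.2)
        hl Computable.fst)
  have heq : Computable₂ fun m n : ℕ => decide (m = n) := Primrec.eq.decide.to_comp
  have hand : Computable₂ and := Primrec.and.to_comp
  have hor : Computable₂ or := Primrec.or.to_comp
  have hnot : Computable not := Primrec.not.to_comp
  refine IsSigma11.of_bounded_use (β := (X × X) × (ℕ × ℕ × ℕ))
    (g := fun t i => l₁ t i + l₂ t i + l₃ t i + 1)
    (Q := fun t i τ => !decide (τ.getD (l₁ t i) 0 = 0) &&
      (!decide (τ.getD (l₂ t i) 0 = i.2.2.1 + 1) || (!ok (ch i.1.1 i.2.1) ||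
        (ok (ch i.1.2 i.2.2.1) && !decide (τ.getD (l₃ t i) 0 = 0))))) ?_ ?_ ?_
  · exact Computable.succ.comp (hadd.comp (hadd.comp hl₁ hl₂) hl₃)
  · refine hand.comp (hnot.comp (heq.comp (lookup hl₁) (Computable.const 0)))
      (hor.comp (hnot.comp (heq.comp (lookup hl₂)
        (Computable.succ.comp (hb.comp Computable.fst))))
      (hor.comp (hnot.comp (hok.comp ((hch.comp hu ha).comp Computable.fst)))
        (hand.comp (hok.comp ((hch.comp hv hb).comp Computable.fst))
          (hnot.comp (heq.comp (lookup hl₃) (Computable.const 0))))))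
  · rintro ⟨u₀, v₀⟩
    have h₁ : ∀ (y : Baire) t i, (pre y (l₁ t i + l₂ t i + l₃ t i + 1)).getD (l₁ t i) 0 =
        y (l₁ t i) := fun y t i => pre_getD y (by omega)
    have h₂ : ∀ (y : Baire) t i, (pre y (l₁ t i + l₂ t i + l₃ t i + 1)).getD (l₂ t i) 0 =
        y (l₂ t i) := fun y t i => pre_getD y (by omega)
    have h₃ : ∀ (y : Baire) t i, (pre y (l₁ t i + l₂ t i + l₃ t i + 1)).getD (l₃ t i) 0 =
        y (l₃ t i) := fun y t i => pre_getD y (by omega)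
    simp only [h₁, h₂, h₃]
    constructor
    · intro h₀
      have hz : ∀ u v a, ∃ z : ℕ, (z ≠ 0 ↔ treeRank ch ok u ≤ treeRank ch ok v) ∧
          ∀ b, z = b + 1 → ok (ch u a) = true →
            ok (ch v b) = true ∧ treeRank ch ok (ch u a) ≤ treeRank ch ok (ch v b) := by
        intro u v a
        by_cases h : treeRank ch ok u ≤ treeRank ch ok v
        · by_cases hk : ok (ch u a) = true
          · obtain ⟨b, hb⟩ := slt_treeRank_iff.1 (treeRank_le_iff.1 h a hk)
            refine ⟨b + 1, by simp [h], fun b' e _ => ?_⟩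
            obtain rfl : b = b' := by omega
            exact hb
          · exact ⟨1, by simp [h], fun b _ h' => absurd h' hk⟩
        · exact ⟨0, by simp [h], fun b e => by omega⟩
      choose z hz₀ hz₁ using hz
      refine ⟨fun n => match (Encodable.decode n : Option (X × X × ℕ)) with
        | some t => z t.1 t.2.1 t.2.2
        | none => 0, ?_⟩
      rintro ⟨⟨u, v⟩, a, b, c⟩
      simp only [l₁, l₂, l₃, e, Encodable.encodek, Bool.and_eq_true, Bool.or_eq_true,
        Bool.not_eq_true', decide_eq_false_iff_not]
      refine ⟨(hz₀ u₀ v₀ a).2 h₀, ?_⟩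
      by_cases e₁ : z u v a = b + 1
      · cases e₂ : ok (ch u a) with
        | false => simp
        | true =>
          have := hz₁ u v a b e₁ e₂
          exact Or.inr (Or.inr ⟨this.1, (hz₀ _ _ _).2 this.2⟩)
      · exact Or.inl e₁
    · rintro ⟨w, hw⟩
      simp only [Bool.and_eq_true, Bool.or_eq_true, Bool.not_eq_true',
        decide_eq_false_iff_not] at hw
      have main : ∀ v, Acc (IsChild ch ok) v → ∀ u, (∀ a, w (e u v a) ≠ 0) →
          treeRank ch ok u ≤ treeRank ch ok v := by
        intro v hv
        induction hv with
        | intro v _ ih =>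
          intro u hu
          refine treeRank_le_iff.2 fun a hk => slt_treeRank_iff.2 ?_
          obtain ⟨b, hb⟩ := Nat.exists_eq_succ_of_ne_zero (hu a)
          have key : ∀ c, ok (ch v b) = true ∧ w (e (ch u a) (ch v b) c) ≠ 0 := by
            intro c
            rcases (hw ((u, v), a, b, c)).2 with h | h | h
            · exact absurd hb h
            · simp [hk] at h
            · exact h
          exact ⟨b, (key 0).1, ih _ ⟨b, rfl, (key 0).1⟩ _ fun c => (key c).2⟩
      by_cases hv : Acc (IsChild ch ok) v₀
      · exact main v₀ hv u₀ fun a => (hw ((u₀, v₀), a, 0, 0)).1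
      · simp only [treeRank_eq_top_iff.2 hv, le_top]

theorem isSigma11_slt_treeRank [Primcodable X] (hch : Computable₂ ch) (hok : Computable ok) :
    IsSigma11 fun t : X × X => SLt (treeRank ch ok t.1) (treeRank ch ok t.2) := by
  have hv : Computable fun t : (X × X) × ℕ => ch t.1.2 t.2 :=
    hch.comp (Computable.snd.comp Computable.fst) Computable.snd
  refine (IsSigma11.exists_nat (p := fun t : (X × X) × ℕ => ok (ch t.1.2 t.2) = true ∧
    treeRank ch ok t.1.1 ≤ treeRank ch ok (ch t.1.2 t.2)) (IsSigma11.and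
      (IsSigma11.of_computable (hok.comp hv)) ?_)).congr fun t => slt_treeRank_iff
  exact (isSigma11_treeRank_le hch hok).comp ((Computable.fst.comp Computable.fst).pair hv)

end TreeRank

/-- A uniformly `Σ¹₁` family comes with ranks that take the value `⊤` exactly at membership
and whose comparisons are `Σ¹₁`. -/
theorem UniformlySigma11.exists_rank {A : ℕ → Set ℕ} (hA : UniformlySigma11 A) :
    ∃ rk : ℕ → ℕ → WithTop Ordinal.{0}, (∀ n m, m ∈ A n ↔ rk n m = ⊤) ∧
      (IsSigma11 fun t : ℕ × ℕ × ℕ => rk t.1 t.2.1 ≤ rk t.1 t.2.2) ∧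
      IsSigma11 fun t : ℕ × ℕ × ℕ => SLt (rk t.1 t.2.1) (rk t.1 t.2.2) := by
  obtain ⟨R, hR, h⟩ := hA
  let ch : (ℕ × ℕ) × List ℕ → ℕ → (ℕ × ℕ) × List ℕ := fun x a => (x.1, x.2 ++ [a])
  let ok : (ℕ × ℕ) × List ℕ → Bool := fun x => R x.1 [] && R x.1 x.2
  have hch : Computable₂ ch := (Computable.fst.comp Computable.fst).pair
    (Computable.list_concat.comp (Computable.snd.comp Computable.fst) Computable.snd)
  have hok : Computable ok := Primrec.and.to_comp.comp
    (hR.comp Computable.fst (Computable.const [])) (hR.comp Computable.fst Computable.snd)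
  have hf : Computable fun t : ℕ × ℕ × ℕ =>
      ((((t.1, t.2.1), []), ((t.1, t.2.2), [])) :
        ((ℕ × ℕ) × List ℕ) × ((ℕ × ℕ) × List ℕ)) :=
    Computable.pair ((Computable.fst.pair (Computable.fst.comp Computable.snd)).pair
      (Computable.const [])) ((Computable.fst.pair (Computable.snd.comp Computable.snd)).pair
      (Computable.const []))
  refine ⟨fun n m => treeRank ch ok ((n, m), []), fun n m => ?_,
    (isSigma11_treeRank_le hch hok).comp hf, (isSigma11_slt_treeRank hch hok).comp hf⟩
  rw [h, treeRank_eq_top_iff_exists]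
  constructor
  · rintro ⟨y, hy⟩
    refine ⟨fun k => ((n, m), pre y k), rfl, fun k => ⟨y k, by simp [ch, pre_succ], ?_⟩⟩
    simp only [ok, Bool.and_eq_true]
    exact ⟨hy 0, hy (k + 1)⟩
  · rintro ⟨s, hs₀, hs⟩
    choose y hy hok' using hs
    have hs' : ∀ k, s k = ((n, m), pre y k) := by
      intro k
      induction k with
      | zero => exact hs₀
      | succ k ih => rw [hy, ih, pre_succ]
    refine ⟨y, fun k => ?_⟩
    simp only [ok, Bool.and_eq_true, hs'] at hok'
    cases k with
    | zero => exact (hok' 0).1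
    | succ k => exact (hok' k).2

/-- `N` is the last number whose rank strictly exceeds almost all ranks, expressed so that
every `N` qualifies when all ranks are `⊤`. -/
def IsLastLarge (r : ℕ → WithTop Ordinal.{0}) (N : ℕ) : Prop :=
  (∀ m M, ∃ k, r (N + 1 + m) ≤ r (M + k)) ∧ ∃ M, ∀ k, SLt (r (M + k)) (r N)

/-- `v` codes the outcome of comparing the ranks of `a` and `b`. -/
def Compares (r : ℕ → WithTop Ordinal.{0}) (a b v : ℕ) : Prop :=
  if v = 0 then SLt (r b) (r a) else if v = 1 then r a ≤ r b else
    SLt (r a) (r b) ∧ SLt (r b) (r a)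

theorem isLastLarge_of_forall_top {r : ℕ → WithTop Ordinal.{0}} (h : ∀ m, r m = ⊤) (N : ℕ) :
    IsLastLarge r N := by
  simp [IsLastLarge, SLt, h]

theorem exists_isLastLarge_iff {r : ℕ → WithTop Ordinal.{0}} (hfin : {m | r m = ⊤}.Finite)
    (hne : {m | r m = ⊤}.Nonempty) :
    ∃ N, (∀ m, r m = ⊤ → m ≤ N) ∧ ∀ N', IsLastLarge r N' ↔ N' = N := by
  let F : Set ℕ := {m | ∃ M, ∀ k, r (M + k) < r m}
  have hF : ∀ m, r m = ⊤ → m ∈ F := by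
    intro m hm
    obtain ⟨M, hM⟩ := hfin.bddAbove
    refine ⟨M + 1, fun k => hm ▸ lt_top_iff_ne_top.2 fun hk => ?_⟩
    have := hM (show M + 1 + k ∈ {m | r m = ⊤} from hk)
    omega
  have hFne : F.Nonempty := hne.mono hF
  have hFfin : F.Finite := by
    obtain ⟨_, ⟨j, ⟨M, hM⟩, rfl⟩, hmin⟩ :=
      (wellFounded_lt (α := WithTop Ordinal.{0})).has_min (r '' F) (hFne.image r)
    refine (Set.finite_Iio M).subset fun m hm => ?_
    by_contra hle
    obtain ⟨k, rfl⟩ := Nat.exists_eq_add_of_le (not_lt.1 hle)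
    exact hmin _ (Set.mem_image_of_mem r hm) (hM k)
  obtain ⟨N, hN, hmax⟩ := Set.exists_max_image F id hFfin hFne
  have h₁ : ∀ N', (∀ m M, ∃ k, r (N' + 1 + m) ≤ r (M + k)) ↔ ∀ m, N' < m → m ∉ F := by
    intro N'
    simp only [F, Set.mem_ofPred_eq, not_exists, not_forall, not_lt]
    refine ⟨fun H m hm => ?_, fun H m => H _ (by omega)⟩
    obtain ⟨d, rfl⟩ := Nat.exists_eq_add_of_le hm
    exact H d
  have h₂ : ∀ N', (∃ M, ∀ k, SLt (r (M + k)) (r N')) ↔ N' ∈ F := by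
    intro N'
    by_cases ht : r N' = ⊤
    · exact ⟨fun _ => hF _ ht, fun _ => ⟨0, fun _ => Or.inl ht⟩⟩
    · simp [F, SLt, ht]
  refine ⟨N, fun m hm => hmax m (hF m hm), fun N' => ?_⟩
  rw [IsLastLarge, h₁, h₂]
  constructor
  · rintro ⟨h, h'⟩
    exact le_antisymm (hmax _ h') (not_lt.1 fun hlt => h N hlt hN)
  · rintro rfl
    exact ⟨fun m hm hmF => absurd (hmax m hmF) (not_le.2 hm), hN⟩

theorem compares_all_or_unique (r : ℕ → WithTop Ordinal.{0}) (a b : ℕ) :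
    (∀ v, Compares r a b v) ∨ ∃ u, ∀ v, Compares r a b v ↔ v = u := by
  by_cases ht : r a = ⊤ ∧ r b = ⊤
  · left
    simp [Compares, SLt, ht.1, ht.2]
  · right
    have hboth : ¬ (SLt (r a) (r b) ∧ SLt (r b) (r a)) := by
      rintro ⟨h | h, h' | h'⟩
      · exact ht ⟨h', h⟩
      · exact not_top_lt (h ▸ h')
      · exact not_top_lt (h' ▸ h)
      · exact lt_asymm h h'
    rcases le_or_gt (r a) (r b) with hle | hlt
    · have hn : ¬ SLt (r b) (r a) := by
        rintro (h | h)
        · exact ht ⟨h, top_le_iff.1 (h ▸ hle)⟩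
        · exact hle.not_gt h
      refine ⟨1, fun v => ?_⟩
      unfold Compares
      split_ifs <;> simp_all
    · refine ⟨0, fun v => ?_⟩
      unfold Compares
      split_ifs with h₀ h₁
      · simp [h₀, SLt, hlt]
      · simp [h₁, hlt]
      · simp [h₀, hboth]

/-- The all-or-unique family attached to a family of ranks. -/
def comparisonFamily (rk : ℕ → ℕ → WithTop Ordinal.{0}) (j : ℕ) : Set ℕ :=
  {v | if j.unpair.2 = 0 then IsLastLarge (rk j.unpair.1) v else
    Compares (rk j.unpair.1) j.unpair.2.pred.unpair.1 j.unpair.2.pred.unpair.2 v}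

theorem mem_comparisonFamily_zero {rk : ℕ → ℕ → WithTop Ordinal.{0}} {n v : ℕ} :
    v ∈ comparisonFamily rk (Nat.pair n 0) ↔ IsLastLarge (rk n) v := by
  simp [comparisonFamily]

theorem mem_comparisonFamily_succ {rk : ℕ → ℕ → WithTop Ordinal.{0}} {n a b v : ℕ} :
    v ∈ comparisonFamily rk (Nat.pair n (Nat.pair a b + 1)) ↔ Compares (rk n) a b v := by
  simp [comparisonFamily]

theorem comparisonFamily_all_or_unique {rk : ℕ → ℕ → WithTop Ordinal.{0}}
    (h : ∀ n, (∀ m, rk n m = ⊤) ∨ {m | rk n m = ⊤}.Nonempty ∧ {m | rk n m = ⊤}.Finite)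
    (j : ℕ) : comparisonFamily rk j = Set.univ ∨ ∃ m, comparisonFamily rk j = {m} := by
  by_cases hj : j.unpair.2 = 0
  · rcases h j.unpair.1 with h | ⟨hne, hfin⟩
    · exact Or.inl (Set.eq_univ_of_forall fun v => by
        simpa [comparisonFamily, hj] using isLastLarge_of_forall_top h v)
    · obtain ⟨N, -, hN⟩ := exists_isLastLarge_iff hfin hne
      exact Or.inr ⟨N, by ext v; simp [comparisonFamily, hj, hN]⟩
  · refine (compares_all_or_unique (rk j.unpair.1) j.unpair.2.pred.unpair.1
      j.unpair.2.pred.unpair.2).imp (fun H => Set.eq_univ_of_forall fun v => ?_) ?_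
    · simpa only [comparisonFamily, hj, if_false] using! H v
    · rintro ⟨u, hu⟩
      exact ⟨u, by ext v; simpa only [comparisonFamily, hj, if_false] using! hu v⟩

theorem uniformlySigma11_comparisonFamily {rk : ℕ → ℕ → WithTop Ordinal.{0}}
    (hle : IsSigma11 fun t : ℕ × ℕ × ℕ => rk t.1 t.2.1 ≤ rk t.1 t.2.2)
    (hlt : IsSigma11 fun t : ℕ × ℕ × ℕ => SLt (rk t.1 t.2.1) (rk t.1 t.2.2)) :
    UniformlySigma11 (comparisonFamily rk) := by
  have hadd : Computable₂ ((· + ·) : ℕ → ℕ → ℕ) := Primrec.nat_add.to_comp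
  have heq : Computable₂ fun m n : ℕ => decide (m = n) := Primrec.eq.decide.to_comp
  have hunpair : Computable Nat.unpair := Primrec.unpair.to_comp
  have hlast : IsSigma11 fun t : ℕ × ℕ => IsLastLarge (rk t.1) t.2 := by
    refine IsSigma11.and ?_ ?_
    · refine (IsSigma11.forall_nat (p := fun t : (ℕ × ℕ) × ℕ =>
        ∀ M, ∃ k, rk t.1.1 (t.1.2 + 1 + t.2) ≤ rk t.1.1 (M + k)) ?_)
      refine (IsSigma11.forall_nat (p := fun t : ((ℕ × ℕ) × ℕ) × ℕ =>
        ∃ k, rk t.1.1.1 (t.1.1.2 + 1 + t.1.2) ≤ rk t.1.1.1 (t.2 + k)) ?_)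
      refine (IsSigma11.exists_nat (p := fun t : (((ℕ × ℕ) × ℕ) × ℕ) × ℕ =>
        rk t.1.1.1.1 (t.1.1.1.2 + 1 + t.1.1.2) ≤ rk t.1.1.1.1 (t.1.2 + t.2)) ?_)
      have h₁ : Computable fun t : (((ℕ × ℕ) × ℕ) × ℕ) × ℕ => t.1.1 :=
        Computable.fst.comp Computable.fst
      have h₀ : Computable fun t : (((ℕ × ℕ) × ℕ) × ℕ) × ℕ => t.1.1.1 := Computable.fst.comp h₁
      exact hle.comp ((Computable.fst.comp h₀).pair
        ((hadd.comp (Computable.succ.comp (Computable.snd.comp h₀)) (Computable.snd.comp h₁)).pair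
          (hadd.comp (Computable.snd.comp Computable.fst) Computable.snd)))
    · refine (IsSigma11.exists_nat (p := fun t : (ℕ × ℕ) × ℕ =>
        ∀ k, SLt (rk t.1.1 (t.2 + k)) (rk t.1.1 t.1.2)) ?_)
      refine (IsSigma11.forall_nat (p := fun t : ((ℕ × ℕ) × ℕ) × ℕ =>
        SLt (rk t.1.1.1 (t.1.2 + t.2)) (rk t.1.1.1 t.1.1.2)) ?_)
      have h₀ : Computable fun t : ((ℕ × ℕ) × ℕ) × ℕ => t.1.1 :=
        Computable.fst.comp Computable.fst
      exact hlt.comp ((Computable.fst.comp h₀).pair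
        ((hadd.comp (Computable.snd.comp Computable.fst) Computable.snd).pair
          (Computable.snd.comp h₀)))
  have hcmp : IsSigma11 fun t : (ℕ × ℕ × ℕ) × ℕ => Compares (rk t.1.1) t.1.2.1 t.1.2.2 t.2 := by
    have hab : IsSigma11 fun t : (ℕ × ℕ × ℕ) × ℕ => SLt (rk t.1.1 t.1.2.1) (rk t.1.1 t.1.2.2) :=
      hlt.comp Computable.fst
    have hba : IsSigma11 fun t : (ℕ × ℕ × ℕ) × ℕ => SLt (rk t.1.1 t.1.2.2) (rk t.1.1 t.1.2.1) :=
      hlt.comp ((Computable.fst.comp Computable.fst).pair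
        ((Computable.snd.comp (Computable.snd.comp Computable.fst)).pair
          (Computable.fst.comp (Computable.snd.comp Computable.fst))))
    refine (IsSigma11.ite (heq.comp Computable.snd (Computable.const 0)) hba
      (IsSigma11.ite (heq.comp Computable.snd (Computable.const 1)) (hle.comp Computable.fst)
        (hab.and hba))).congr fun t => ?_
    simp [Compares]
  have hn : Computable fun t : ℕ × ℕ => t.1.unpair.1 :=
    Computable.fst.comp (hunpair.comp Computable.fst)
  have hi : Computable fun t : ℕ × ℕ => t.1.unpair.2 :=
    Computable.snd.comp (hunpair.comp Computable.fst)
  have hB : IsSigma11 fun t : ℕ × ℕ => t.2 ∈ comparisonFamily rk t.1 := by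
    refine (IsSigma11.ite (heq.comp hi (Computable.const 0))
      (hlast.comp (hn.pair Computable.snd))
      (hcmp.comp ((hn.pair (hunpair.comp (Computable.pred.comp hi))).pair
        Computable.snd))).congr fun t => ?_
    simp [comparisonFamily]
  obtain ⟨R, hR, h⟩ := hB
  exact ⟨R, hR, fun n m => h (n, m)⟩

/-- The winner among `0, …, i` of the knockout tournament for row `n` whose results are
recorded in `x`. -/
def champion (x : Baire) (n : ℕ) : ℕ → ℕ
  | 0 => 0
  | i + 1 => if x (Nat.pair n (Nat.pair (champion x n i) (i + 1) + 1)) = 1 then i + 1 else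
      champion x n i

theorem champion_eq_top {rk : ℕ → ℕ → WithTop Ordinal.{0}} {x : Baire}
    (hx : x ∈ homProd (comparisonFamily rk)) {n i a : ℕ} (ha : a ≤ i) (htop : rk n a = ⊤) :
    rk n (champion x n i) = ⊤ := by
  induction i with
  | zero =>
    obtain rfl : a = 0 := by omega
    exact htop
  | succ i ih =>
    have hc := mem_comparisonFamily_succ.1
      (hx (Nat.pair n (Nat.pair (champion x n i) (i + 1) + 1)))
    rcases Nat.lt_or_ge i a with hlt | hle
    · obtain rfl : a = i + 1 := by omega
      rw [champion]
      split_ifs with h₁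
      · exact htop
      · by_contra hne
        have hs : SLt (rk n (i + 1)) (rk n (champion x n i)) := by
          unfold Compares at hc
          split_ifs at hc
          · exact hc
          · exact hc.2
        rcases hs with hs | hs
        · exact hne hs
        · exact not_top_lt (htop ▸ hs)
    · rw [champion]
      split_ifs with h₁
      · rw [h₁] at hc
        have hle' : rk n (champion x n i) ≤ rk n (i + 1) := by simpa [Compares] using hc
        exact top_le_iff.1 (ih hle ▸ hle')
      · exact ih hle

/-- The tournament winner computed from a finite part of the record, if that suffices. -/
def champion? (σ : List ℕ) (n : ℕ) : ℕ → Option ℕ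
  | 0 => some 0
  | i + 1 => (champion? σ n i).bind fun c =>
      (σ[Nat.pair n (Nat.pair c (i + 1) + 1)]?).map fun v => if v = 1 then i + 1 else c

/-- The value at `n` of the reduction computed from a finite part of the oracle. -/
def output? (σ : List ℕ) (n : ℕ) : Option ℕ := (σ[Nat.pair n 0]?).bind (champion? σ n)

/-- The longest list of at most `k` consecutive outputs computed from `σ`. -/
def outputs (σ : List ℕ) : ℕ → List ℕ
  | 0 => []
  | k + 1 => ((output? σ (outputs σ k).length).map fun v => outputs σ k ++ [v]).getD (outputs σ k)

theorem primrec_output? : Primrec₂ output? := by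
  have hch : Primrec fun t : (List ℕ × ℕ) × ℕ => champion? t.1.1 t.1.2 t.2 := by
    have hstep : Primrec₂ fun (t : (List ℕ × ℕ) × ℕ) (s : ℕ × Option ℕ) =>
        s.2.bind fun c => (t.1.1[Nat.pair t.1.2 (Nat.pair c (s.1 + 1) + 1)]?).map
          fun v => if v = 1 then s.1 + 1 else c := by
      refine Primrec.option_bind (Primrec.snd.comp Primrec.snd) ?_
      have hi : Primrec fun t : (((List ℕ × ℕ) × ℕ) × ℕ × Option ℕ) × ℕ => t.1.2.1 + 1 :=
        Primrec.succ.comp (Primrec.fst.comp (Primrec.snd.comp Primrec.fst))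
      have hσ : Primrec fun t : (((List ℕ × ℕ) × ℕ) × ℕ × Option ℕ) × ℕ => t.1.1.1 :=
        Primrec.fst.comp (Primrec.fst.comp Primrec.fst)
      refine Primrec.option_map (Primrec.list_getElem?.comp (Primrec.fst.comp hσ)
        (Primrec₂.natPair.comp (Primrec.snd.comp hσ)
          (Primrec.succ.comp (Primrec₂.natPair.comp Primrec.snd hi)))) ?_
      exact Primrec.ite (Primrec.eq.comp Primrec.snd (Primrec.const 1)) (hi.comp Primrec.fst)
        (Primrec.snd.comp Primrec.fst)
    refine (Primrec.nat_rec' Primrec.snd (Primrec.const (some 0)) hstep).of_eq fun t => ?_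
    obtain ⟨⟨σ, n⟩, i⟩ := t
    induction i with
    | zero => rfl
    | succ i ih => simp only [champion?, ← ih]
  exact Primrec.option_bind (Primrec.list_getElem?.comp Primrec.fst
    (Primrec₂.natPair.comp Primrec.snd (Primrec.const 0))) hch

theorem primrec_outputs : Primrec₂ outputs := by
  have hstep : Primrec₂ fun (t : List ℕ × ℕ) (s : ℕ × List ℕ) =>
      ((output? t.1 s.2.length).map fun v => s.2 ++ [v]).getD s.2 := by
    have hl : Primrec fun t : (List ℕ × ℕ) × ℕ × List ℕ => t.2.2 :=
      Primrec.snd.comp Primrec.snd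
    refine Primrec.option_getD.comp (Primrec.option_map (primrec_output?.comp
      (Primrec.fst.comp Primrec.fst) (Primrec.list_length.comp hl)) ?_) hl
    exact Primrec.list_concat.comp (hl.comp Primrec.fst) Primrec.snd
  refine (Primrec.nat_rec' Primrec.snd (Primrec.const []) hstep).of_eq fun t => ?_
  obtain ⟨σ, k⟩ := t
  induction k with
  | zero => rfl
  | succ k ih => simp only [outputs, ← ih]

theorem getElem?_mono {σ τ : List ℕ} (h : σ <+: τ) {i v : ℕ} (hv : σ[i]? = some v) :
    τ[i]? = some v := by
  obtain ⟨ρ, rfl⟩ := h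
  rw [List.getElem?_append_left (List.getElem?_eq_some_iff.1 hv).1, hv]

theorem champion?_mono {σ τ : List ℕ} (h : σ <+: τ) {n i c : ℕ}
    (hc : champion? σ n i = some c) : champion? τ n i = some c := by
  induction i generalizing c with
  | zero => exact hc
  | succ i ih =>
    simp only [champion?, Option.bind_eq_some_iff, Option.map_eq_some_iff] at hc ⊢
    obtain ⟨d, hd, v, hv, e⟩ := hc
    exact ⟨d, ih hd, v, getElem?_mono h hv, e⟩

theorem output?_mono {σ τ : List ℕ} (h : σ <+: τ) {n v : ℕ} (hv : output? σ n = some v) :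
    output? τ n = some v := by
  simp only [output?, Option.bind_eq_some_iff] at hv ⊢
  obtain ⟨N, hN, hc⟩ := hv
  exact ⟨N, getElem?_mono h hN, champion?_mono h hc⟩

theorem outputs_prefix_succ (σ : List ℕ) (k : ℕ) : outputs σ k <+: outputs σ (k + 1) := by
  rw [outputs]
  cases output? σ (outputs σ k).length <;> simp

theorem outputs_prefix_of_le (σ : List ℕ) {k l : ℕ} (h : k ≤ l) :
    outputs σ k <+: outputs σ l := by
  induction h with
  | refl => exact List.prefix_refl _
  | step _ ih => exact ih.trans (outputs_prefix_succ σ _)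

theorem output?_of_getElem?_outputs {σ : List ℕ} {k n v : ℕ}
    (h : (outputs σ k)[n]? = some v) : output? σ n = some v := by
  induction k with
  | zero => simp [outputs] at h
  | succ k ih =>
    rw [outputs] at h
    cases e : output? σ (outputs σ k).length with
    | none => exact ih (by simpa [e] using h)
    | some w =>
      simp only [e, Option.map_some, Option.getD_some] at h
      rcases lt_trichotomy n (outputs σ k).length with hn | rfl | hn
      · exact ih (by rwa [List.getElem?_append_left hn] at h)
      · simp_all
      · rw [List.getElem?_eq_none (by simp; omega)] at h
        cases h

theorem length_outputs {σ : List ℕ} {k : ℕ} (h : ∀ n < k, ∃ v, output? σ n = some v) :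
    (outputs σ k).length = k := by
  induction k with
  | zero => rfl
  | succ k ih =>
    have hk := ih fun n hn => h n (by omega)
    obtain ⟨v, hv⟩ := h k (by omega)
    simp [outputs, hk, hv]

theorem outputs_mono {σ τ : List ℕ} (h : σ <+: τ) (k : ℕ) : outputs σ k <+: outputs τ k := by
  set l := (outputs σ k).length with hl
  have hdef : ∀ n < l, ∃ v, (outputs σ k)[n]? = some v := fun n hn =>
    ⟨_, List.getElem?_eq_getElem (hl ▸ hn)⟩
  have hlk : l ≤ k := by
    rw [hl]
    clear hdef hl
    induction k with
    | zero => simp [outputs]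
    | succ k ih =>
      rw [outputs]
      cases output? σ (outputs σ k).length <;> simp <;> omega
  have hlen : (outputs τ l).length = l := length_outputs fun n hn => by
    obtain ⟨v, hv⟩ := hdef n hn
    exact ⟨v, output?_mono h (output?_of_getElem?_outputs hv)⟩
  have heq : outputs σ k = outputs τ l := by
    refine List.ext_getElem? fun n => ?_
    by_cases hn : n < l
    · obtain ⟨v, hv⟩ := hdef n hn
      have h₁ := output?_mono h (output?_of_getElem?_outputs hv)
      have h₂ := List.getElem?_eq_getElem (hlen.symm ▸ hn : n < (outputs τ l).length)
      have h₃ := output?_of_getElem?_outputs h₂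
      rw [hv, h₂, ← h₁, h₃]
    · rw [List.getElem?_eq_none (by omega), List.getElem?_eq_none (by omega)]
  rw [heq]
  exact outputs_prefix_of_le τ hlk

/-- The reduction running, for each row, the tournament up to the recorded bound. -/
def tournamentFunctional : TuringFunctional where
  φ σ := outputs σ σ.length
  computable := (primrec_outputs.comp Primrec.id Primrec.list_length).to_comp
  mono _ τ h := (outputs_mono h _).trans (outputs_prefix_of_le τ h.length_le)

theorem eventually_pre_getElem? (x : Baire) (i : ℕ) :
    ∀ᶠ m in Filter.atTop, (pre x m)[i]? = some (x i) :=
  (Filter.eventually_gt_atTop i).mono fun _ hm => pre_getElem? x hm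

theorem eventually_champion? (x : Baire) (n i : ℕ) :
    ∀ᶠ m in Filter.atTop, champion? (pre x m) n i = some (champion x n i) := by
  induction i with
  | zero => exact Filter.Eventually.of_forall fun _ => rfl
  | succ i ih =>
    filter_upwards [ih, eventually_pre_getElem? x
      (Nat.pair n (Nat.pair (champion x n i) (i + 1) + 1))] with m h₁ h₂
    simp [champion?, champion, h₁, h₂]

theorem eventually_output? (x : Baire) (n : ℕ) : ∀ᶠ m in Filter.atTop,
    output? (pre x m) n = some (champion x n (x (Nat.pair n 0))) := by
  filter_upwards [eventually_pre_getElem? x (Nat.pair n 0),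
    eventually_champion? x n (x (Nat.pair n 0))] with m h₁ h₂
  simp [output?, h₁, h₂]

theorem tournamentFunctional_eval (x : Baire) :
    tournamentFunctional.Eval x fun n => champion x n (x (Nat.pair n 0)) := by
  intro n
  have hall : ∀ᶠ m in Filter.atTop, ∀ i ∈ Finset.range (n + 1),
      output? (pre x m) i = some (champion x i (x (Nat.pair i 0))) :=
    (Filter.eventually_all_finset _).2 fun i _ => eventually_output? x i
  obtain ⟨m, hm, hnm⟩ := (hall.and (Filter.eventually_gt_atTop n)).exists
  have hlen : (outputs (pre x m) (n + 1)).length = n + 1 :=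
    length_outputs fun i hi => ⟨_, hm i (Finset.mem_range.2 hi)⟩
  have hget := List.getElem?_eq_getElem (by omega : n < (outputs (pre x m) (n + 1)).length)
  have hpre : outputs (pre x m) (n + 1) <+: outputs (pre x m) (pre x m).length :=
    outputs_prefix_of_le _ (by rw [pre_length]; exact hnm)
  refine ⟨m, getElem?_mono hpre ?_⟩
  rw [hget, ← output?_of_getElem?_outputs hget, hm n (by simp)]

/-- Every all-or-(nonempty-finite) homogeneous `Σ¹₁` set is Medvedev reducible
to an all-or-unique homogeneous `Σ¹₁` set. -/
theorem aof_reducible_to_aou :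
    ∀ A : ℕ → Set ℕ, UniformlySigma11 A →
      (∀ n, A n = Set.univ ∨ ((A n).Nonempty ∧ (A n).Finite)) →
      ∃ B : ℕ → Set ℕ, UniformlySigma11 B ∧
        (∀ k, B k = Set.univ ∨ ∃ m, B k = {m}) ∧
        MedvedevLE (homProd A) (homProd B) := by
  intro A hA hall
  obtain ⟨rk, hmem, hle, hlt⟩ := hA.exists_rank
  have hset : ∀ n, A n = {m | rk n m = ⊤} := fun n => Set.ext (hmem n)
  refine ⟨comparisonFamily rk, uniformlySigma11_comparisonFamily hle hlt,
    comparisonFamily_all_or_unique fun n => ?_, tournamentFunctional, fun x hx =>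
    ⟨_, fun n => ?_, tournamentFunctional_eval x⟩⟩
  · rcases hall n with h | h
    · exact Or.inl fun m => (hmem n m).1 (h ▸ Set.mem_univ m)
    · exact Or.inr (hset n ▸ h)
  · rcases hall n with h | ⟨hne, hfin⟩
    · exact h ▸ Set.mem_univ _
    · rw [hset n] at hne hfin
      obtain ⟨N, hN, huniq⟩ := exists_isLastLarge_iff hfin hne
      have hxN := (huniq _).1 (mem_comparisonFamily_zero.1 (hx (Nat.pair n 0)))
      obtain ⟨a, ha⟩ := hne
      exact (hmem n _).2 (champion_eq_top hx (hxN ▸ hN a ha) ha)
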